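/- arXiv:2304.07351 — 3 statements merged into one kernel-verified Lean document; each statement's English description precedes it below -/
import Mathlib

section
/- Let $F$ be a field, let $n \ge 3$, and let $z_1,\dots,z_n \in F$ be pairwise distinct. Then the sum of Parke-Taylor factors over all $n-1$ insertions of the label $n$ into the cyclic ordering $(1,2,\dots,n-1)$ vanishes: $\sum_{j=1}^{n-1} \mathrm{PT}(1,2,\dots,j,n,j+1,\dots,n-1) = 0$. (This is the $k=2$ $U(1)$ decoupling identity.) -/
/-- The Parke-Taylor factor of a list of labels `l`, with points `z`:
`∏ m, (z l_m - z l_{m+1})⁻¹`, indices read cyclically. -/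
noncomputable def PTl {F : Type*} [Field F] (z : ℕ → F) (l : List ℕ) : F :=
  ∏ m : Fin l.length, (z (l.get m) - z (l.get (finRotate l.length m)))⁻¹

/-- The product of `(z a - z b)⁻¹` over consecutive labels `a, b` of a list `l` followed by `e`. -/
noncomputable def chainProd {F : Type*} [Field F] (z : ℕ → F) (e : ℕ) : List ℕ → F
  | [] => 1
  | a :: l => (z a - z (l.headD e))⁻¹ * chainProd z e l

theorem chainProd_append {F : Type*} [Field F] (z : ℕ → F) (e : ℕ) (l₁ l₂ : List ℕ) :
    chainProd z e (l₁ ++ l₂) = chainProd z (l₂.headD e) l₁ * chainProd z e l₂ := by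
  induction l₁ with
  | nil => simp [chainProd]
  | cons a l ih =>
    have h : (l ++ l₂).headD e = l.headD (l₂.headD e) := by cases l <;> simp
    rw [List.cons_append, chainProd, chainProd, ih, h, mul_assoc]

theorem chainProd_eq_prod {F : Type*} [Field F] (z : ℕ → F) (e : ℕ) (l : List ℕ) :
    chainProd z e l =
      ∏ i : Fin l.length, (z (l.get i) - z (l.getD ((i : ℕ) + 1) e))⁻¹ := by
  induction l with
  | nil => simp [chainProd]
  | cons a l ih =>
    rw [chainProd, ih]
    refine Eq.trans ?_ (Fin.prod_univ_succ (n := l.length) _).symm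
    have h : l.headD e = l.getD 0 e := by cases l <;> simp
    simp only [h, List.get_eq_getElem, Fin.val_zero, Fin.val_succ, List.getElem_cons_zero,
      List.getElem_cons_succ, List.getD_cons_succ]

theorem PTl_cons {F : Type*} [Field F] (z : ℕ → F) (a : ℕ) (l : List ℕ) :
    PTl z (a :: l) = chainProd z a (a :: l) := by
  rw [chainProd_eq_prod, PTl]
  refine Finset.prod_congr rfl fun m _ => ?_
  have h : (a :: l).get (finRotate (a :: l).length m) = (a :: l).getD ((m : ℕ) + 1) a := by
    change (a :: l).get (finRotate (l.length + 1) m) = _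
    rw [List.get_eq_getElem]
    simp only [coe_finRotate]
    split_ifs with hm
    · subst hm
      simp
    · have hlt : (m : ℕ) < l.length := Fin.val_lt_last hm
      simp [hlt]
  rw [h]

/-- Inserting `x` between `a` and its successor multiplies a chain product by the difference
of `(z a - z x)⁻¹` and the corresponding term for the successor. -/
theorem chainProd_insert {F : Type*} [Field F] (z : ℕ → F) (e a x : ℕ) (l₁ l₂ : List ℕ)
    (hax : z a ≠ z x) (hx : z (l₂.headD e) ≠ z x) (ha : z a ≠ z (l₂.headD e)) :
    chainProd z e (l₁ ++ a :: x :: l₂) =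
      chainProd z e (l₁ ++ a :: l₂) * ((z a - z x)⁻¹ - (z (l₂.headD e) - z x)⁻¹) := by
  rw [chainProd_append, chainProd_append]
  simp only [chainProd, List.headD_cons]
  generalize l₂.headD e = b at *
  have h1 : z a - z x ≠ 0 := sub_ne_zero.2 hax
  have h2 : z b - z x ≠ 0 := sub_ne_zero.2 hx
  have h3 : z a - z b ≠ 0 := sub_ne_zero.2 ha
  have key : (z a - z x)⁻¹ * (z x - z b)⁻¹ =
      (z a - z b)⁻¹ * ((z a - z x)⁻¹ - (z b - z x)⁻¹) := by
    have h4 : z x - z b ≠ 0 := sub_ne_zero.2 hx.symm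
    field_simp
    ring
  linear_combination chainProd z a l₁ * chainProd z e l₂ * key

/-- The `k = 2` `U(1)` decoupling identity: the sum of Parke-Taylor factors over all
`n - 1` insertions of the label `n` into the cyclic ordering `(1, 2, …, n-1)` vanishes. -/
theorem stmt0 {F : Type*} [Field F] (n : ℕ) (hn : 3 ≤ n) (z : ℕ → F)
    (hz : ∀ a ∈ Finset.Icc 1 n, ∀ b ∈ Finset.Icc 1 n, z a = z b → a = b) :
    ∑ j ∈ Finset.Icc 1 (n - 1),
      PTl z (List.range' 1 j ++ [n] ++ List.range' (j + 1) (n - 1 - j)) = 0 := by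
  have hne : ∀ a b, 1 ≤ a → a ≤ n → 1 ≤ b → b ≤ n → a ≠ b → z a ≠ z b :=
    fun a b ha ha' hb hb' hab h =>
      hab (hz a (Finset.mem_Icc.2 ⟨ha, ha'⟩) b (Finset.mem_Icc.2 ⟨hb, hb'⟩) h)
  let v : ℕ → F := fun j => (z (if j = n then 1 else j) - z n)⁻¹
  have hterm : ∀ j ∈ Finset.Icc 1 (n - 1),
      PTl z (List.range' 1 j ++ [n] ++ List.range' (j + 1) (n - 1 - j)) =
        chainProd z 1 (List.range' 1 (n - 1)) * (v j - v (j + 1)) := by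
    intro j hj
    obtain ⟨hj1, hj2⟩ := Finset.mem_Icc.1 hj
    obtain ⟨i, rfl⟩ : ∃ i, j = i + 1 := ⟨j - 1, by omega⟩
    have hhead : (List.range' (i + 1 + 1) (n - 1 - (i + 1))).headD 1 =
        if i + 1 + 1 = n then 1 else i + 1 + 1 := by
      split_ifs with h
      · rw [show n - 1 - (i + 1) = 0 by omega]
        rfl
      · rw [show n - 1 - (i + 1) = (n - 1 - (i + 1) - 1) + 1 by omega, List.range'_succ]
        rfl
    have hsplit : List.range' 1 (i + 1) = List.range' 1 i ++ [i + 1] := by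
      rw [List.range'_1_concat, add_comm 1 i]
    have hfull : List.range' 1 (n - 1) =
        List.range' 1 i ++ (i + 1) :: List.range' (i + 1 + 1) (n - 1 - (i + 1)) := by
      rw [← List.range'_succ, show n - 1 = i + (n - 1 - (i + 1) + 1) by omega,
        ← List.range'_append_1, add_comm 1 i]
      congr 2
      omega
    have hPT : PTl z (List.range' 1 (i + 1) ++ [n] ++
          List.range' (i + 1 + 1) (n - 1 - (i + 1))) =
        chainProd z 1 (List.range' 1 i ++ (i + 1) :: n ::
          List.range' (i + 1 + 1) (n - 1 - (i + 1))) := by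
      rw [List.range'_succ, List.cons_append, List.cons_append, PTl_cons,
        ← List.cons_append, ← List.cons_append, ← List.range'_succ, hsplit]
      simp
    rw [hPT, chainProd_insert, ← hfull, hhead]
    · simp only [v]
      rw [if_neg (show i + 1 ≠ n by omega)]
    · exact hne _ _ (by omega) (by omega) (by omega) (by omega) (by omega)
    · rw [hhead]
      split_ifs <;> exact hne _ _ (by omega) (by omega) (by omega) (by omega) (by omega)
    · rw [hhead]
      split_ifs <;> exact hne _ _ (by omega) (by omega) (by omega) (by omega) (by omega)
  rw [Finset.sum_congr rfl hterm, ← Finset.mul_sum]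
  have htel : ∑ j ∈ Finset.Icc 1 (n - 1), (v j - v (j + 1)) = v 1 - v n := by
    rw [show Finset.Icc 1 (n - 1) = Finset.Ico 1 n by ext; simp; omega,
      Finset.sum_Ico_eq_sum_range]
    have := Finset.sum_range_sub' (fun k => v (1 + k)) (n - 1)
    simpa only [add_assoc, add_zero, show 1 + (n - 1) = n by omega] using this
  have hv : v 1 = v n := by simp [v]
  rw [htel, hv, sub_self, mul_zero]
end

section
/- Let $F$ be a field, let $n \ge 4$, and let $N$ be an $(n-2) \times n$ matrix over $F$ all of whose maximal ($(n-2)\times(n-2)$) minors are nonzero. For $1 \le i \le n-2$, the degenerated Kleiss-Kuijf relation holds: $\sum_{\gamma \in (1,\dots,i) \,\shuffle\, (i+1,\dots,n-1)} \operatorname{sgn}(\gamma)^{n}\, \mathrm{PT}^{(n-2)}(\gamma_1,\dots,\gamma_{n-1},n) = 0$, where $\operatorname{sgn}(\gamma)$ is the sign of $\gamma$ viewed as a permutation of $(1,\dots,n-1)$ and the sum runs over all shuffles $\gamma$ of the ordered lists $(1,\dots,i)$ and $(i+1,\dots,n-1)$. -/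
/-- The Plücker coordinate/maximal minor of a `k × n` matrix on the columns
`cols 0, …, cols (k-1)`, taken in that order. -/
noncomputable def Delta {F : Type*} [Field F] {k n : ℕ} (N : Matrix (Fin k) (Fin n) F)
    (cols : Fin k → Fin n) : F :=
  (N.submatrix id cols).det

/-- The generalized Parke-Taylor factor `PT^(k)` of an ordering given as a list `l` of
column labels: `∏ m, Δ_{l_m l_{m+1} ⋯ l_{m+k-1}}⁻¹`, with indices read cyclically. -/
noncomputable def PTk {F : Type*} [Field F] {k n : ℕ} (N : Matrix (Fin k) (Fin n) F)
    (l : List (Fin n)) : F :=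
  ∏ m : Fin l.length,
    (Delta N (fun c : Fin k => l.get ⟨(m.val + c.val) % l.length, Nat.mod_lt _ m.pos⟩))⁻¹

/-- The sign of a list `γ`, viewed as a permutation of its sorted version:
`(-1)` to the number of inversions. -/
def listSign (γ : List ℕ) : ℤ :=
  (-1) ^ ((Finset.univ : Finset (Fin γ.length × Fin γ.length)).filter
    (fun pq => pq.1 < pq.2 ∧ γ.get pq.2 < γ.get pq.1)).card

/-- The interleavings of two lists that preserve the order of each of them. -/
def shuffles {α : Type*} [DecidableEq α] (ρ ω : List α) : Finset (List α) :=
  (ρ ++ ω).permutations.toFinset.filter (fun γ => List.Sublist ρ γ ∧ List.Sublist ω γ)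

theorem mem_shuffles {α : Type*} [DecidableEq α] {ρ ω γ : List α} :
    γ ∈ shuffles ρ ω ↔ γ.Perm (ρ ++ ω) ∧ List.Sublist ρ γ ∧ List.Sublist ω γ := by
  simp [shuffles]

theorem shuffles_nil_left {α : Type*} [DecidableEq α] (ω : List α) : shuffles [] ω = {ω} := by
  ext γ
  simp only [mem_shuffles, List.nil_append, List.nil_sublist, true_and, Finset.mem_singleton]
  exact ⟨fun h => (h.2.eq_of_length h.1.length_eq.symm).symm, fun h => by simp [h]⟩

theorem shuffles_nil_right {α : Type*} [DecidableEq α] (ρ : List α) : shuffles ρ [] = {ρ} := by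
  ext γ
  simp only [mem_shuffles, List.append_nil, List.nil_sublist, and_true, Finset.mem_singleton]
  exact ⟨fun h => (h.2.eq_of_length h.1.length_eq.symm).symm, fun h => by simp [h]⟩

theorem cons_mem_shuffles_left {α : Type*} [DecidableEq α] {a b : α} {ρ ω γ : List α}
    (hab : a ≠ b) : a :: γ ∈ shuffles (a :: ρ) (b :: ω) ↔ γ ∈ shuffles ρ (b :: ω) := by
  simp [mem_shuffles, List.sublist_cons_iff (l := b :: ω), hab.symm]

theorem cons_mem_shuffles_right {α : Type*} [DecidableEq α] {a b : α} {ρ ω γ : List α}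
    (hab : a ≠ b) : b :: γ ∈ shuffles (a :: ρ) (b :: ω) ↔ γ ∈ shuffles (a :: ρ) ω := by
  have h : (b :: γ).Perm (a :: ρ ++ b :: ω) ↔ γ.Perm (a :: ρ ++ ω) :=
    ⟨fun h => (h.trans List.perm_middle).cons_inv, fun h => (h.cons b).trans List.perm_middle.symm⟩
  rw [mem_shuffles, mem_shuffles, h]
  simp [List.sublist_cons_iff (l := a :: ρ), hab]

theorem shuffles_cons_cons {α : Type*} [DecidableEq α] {a b : α} {ρ ω : List α}
    (h : (a :: ρ ++ b :: ω).Nodup) :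
    shuffles (a :: ρ) (b :: ω) =
      (shuffles ρ (b :: ω)).image (List.cons a) ∪ (shuffles (a :: ρ) ω).image (List.cons b) := by
  have hab : a ≠ b := by rintro rfl; simp at h
  ext γ
  simp only [Finset.mem_union, Finset.mem_image]
  constructor
  · intro hγ
    obtain ⟨hp, h1, h2⟩ := mem_shuffles.1 hγ
    cases γ with
    | nil => simp at h1
    | cons x γ =>
      by_cases hxa : x = a
      · subst hxa
        exact Or.inl ⟨γ, (cons_mem_shuffles_left hab).1 hγ, rfl⟩
      by_cases hxb : x = b
      · subst hxb
        exact Or.inr ⟨γ, (cons_mem_shuffles_right hab).1 hγ, rfl⟩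
      exfalso
      have h1' : (a :: ρ).Sublist γ := by
        simpa [List.sublist_cons_iff (l := a :: ρ), Ne.symm hxa] using h1
      have h2' : (b :: ω).Sublist γ := by
        simpa [List.sublist_cons_iff (l := b :: ω), Ne.symm hxb] using h2
      have hx : x ∈ a :: ρ ++ b :: ω := hp.subset (by simp)
      have hn : (x :: γ).Nodup := hp.nodup_iff.2 h
      refine (List.nodup_cons.1 hn).1 ?_
      rcases List.mem_append.1 hx with hx | hx
      · exact h1'.subset hx
      · exact h2'.subset hx
  · rintro (⟨γ, hγ, rfl⟩ | ⟨γ, hγ, rfl⟩)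
    · exact (cons_mem_shuffles_left hab).2 hγ
    · exact (cons_mem_shuffles_right hab).2 hγ

theorem sum_shuffles_cons_cons {α M : Type*} [DecidableEq α] [AddCommMonoid M] {a b : α}
    {ρ ω : List α} (h : (a :: ρ ++ b :: ω).Nodup) (f : List α → M) :
    ∑ γ ∈ shuffles (a :: ρ) (b :: ω), f γ =
      ∑ γ ∈ shuffles ρ (b :: ω), f (a :: γ) + ∑ γ ∈ shuffles (a :: ρ) ω, f (b :: γ) := by
  have hab : a ≠ b := by rintro rfl; simp at h
  rw [shuffles_cons_cons h, Finset.sum_union, Finset.sum_image, Finset.sum_image]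
  · simp
  · simp
  · rw [Finset.disjoint_left]
    simp only [Finset.mem_image, not_exists, not_and]
    rintro _ ⟨γ, -, rfl⟩ γ' - h'
    exact hab (List.cons.inj h').1.symm

/-- The weight `∏ (p lⱼ lⱼ₊₁)⁻¹` of the path that follows the list `l` and ends at `z`. -/
def pathWeight {α F : Type*} [Field F] (p : α → α → F) (z : α) : List α → F
  | [] => 1
  | [a] => (p a z)⁻¹
  | a :: b :: l => (p a b)⁻¹ * pathWeight p z (b :: l)

theorem sum_shuffles_pathWeight_cons {α F : Type*} [DecidableEq α] [Field F] {p : α → α → F} {z : α}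
    (hanti : ∀ a b, p a b = -p b a)
    (hpl : ∀ a b c, p c z * p a b = p c b * p a z - p c a * p b z)
    {c : α} {ρ ω : List α} (hne : {x | x ∈ z :: c :: (ρ ++ ω)}.Pairwise fun a b => p a b ≠ 0)
    (hnd : (z :: c :: (ρ ++ ω)).Nodup) :
    ∑ γ ∈ shuffles ρ ω, pathWeight p z (c :: γ) =
      pathWeight p z (c :: ρ) * pathWeight p z (c :: ω) * p c z := by
  induction hk : ρ.length + ω.length using Nat.strong_induction_on generalizing c ρ ω with
  | _ k ih =>
  have hcz : p c z ≠ 0 := hne (by simp) (by simp) (by rintro rfl; simp at hnd)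
  match ρ, ω with
  | [], ω => simp [shuffles_nil_left, pathWeight]; field_simp
  | ρ, [] => simp [shuffles_nil_right, pathWeight]; field_simp
  | a :: ρ, b :: ω =>
    have hnd' : (a :: ρ ++ b :: ω).Nodup := (List.nodup_cons.1 (List.nodup_cons.1 hnd).2).2
    have hca : p c a ≠ 0 := hne (by simp) (by simp) (by rintro rfl; simp at hnd)
    have hcb : p c b ≠ 0 := hne (by simp) (by simp) (by rintro rfl; simp at hnd)
    have hab : p a b ≠ 0 := hne (by simp) (by simp) (by rintro rfl; simp at hnd)
    have hba : p b a = -p a b := hanti b a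
    rw [sum_shuffles_cons_cons hnd']
    simp only [pathWeight, ← Finset.mul_sum]
    have hperm : (z :: b :: (a :: ρ ++ ω)).Perm (z :: (a :: ρ ++ b :: ω)) :=
      (List.perm_middle (l₁ := a :: ρ)).symm.cons z
    have hsub : List.Sublist (z :: (a :: ρ ++ b :: ω)) (z :: c :: (a :: ρ ++ b :: ω)) := by simp
    rw [ih _ (by simp at hk ⊢; omega) (c := a) (ρ := ρ) (ω := b :: ω)
        (hne.mono fun x hx => hsub.subset hx) (hnd.sublist hsub) rfl,
      ih _ (by simp at hk ⊢; omega) (c := b) (ρ := a :: ρ) (ω := ω)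
        (hne.mono fun x hx => hsub.subset (hperm.subset hx)) (hperm.nodup_iff.2 (hnd.sublist hsub))
        rfl]
    have := hpl a b c
    simp only [pathWeight, hba]
    field_simp
    linear_combination (-pathWeight p z (a :: ρ) * pathWeight p z (b :: ω)) * this

theorem sum_shuffles_closed_pathWeight {α F : Type*} [DecidableEq α] [Field F] {p : α → α → F}
    {z a b : α} (hanti : ∀ a b, p a b = -p b a)
    (hpl : ∀ a b c, p c z * p a b = p c b * p a z - p c a * p b z)
    {ρ ω : List α}
    (hne : {x | x ∈ z :: (a :: ρ ++ b :: ω)}.Pairwise fun a b => p a b ≠ 0)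
    (hnd : (z :: (a :: ρ ++ b :: ω)).Nodup) :
    ∑ γ ∈ shuffles (a :: ρ) (b :: ω), pathWeight p z γ * (p z (γ.headD z))⁻¹ = 0 := by
  have hperm : (z :: b :: (a :: ρ ++ ω)).Perm (z :: (a :: ρ ++ b :: ω)) :=
    (List.perm_middle (l₁ := a :: ρ)).symm.cons z
  have haz : p a z ≠ 0 := hne (by simp) (by simp) (by rintro rfl; simp at hnd)
  have hbz : p b z ≠ 0 := hne (by simp) (by simp) (by rintro rfl; simp at hnd)
  have hab : p a b ≠ 0 := hne (by simp) (by simp) (by rintro rfl; simp at hnd)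
  rw [sum_shuffles_cons_cons (List.nodup_cons.1 hnd).2]
  simp only [List.headD_cons, ← Finset.sum_mul]
  rw [sum_shuffles_pathWeight_cons hanti hpl (c := a) (ρ := ρ) (ω := b :: ω) hne hnd,
    sum_shuffles_pathWeight_cons hanti hpl (c := b) (ρ := a :: ρ) (ω := ω)
      (hne.mono fun x hx => hperm.subset hx) (hperm.nodup_iff.2 hnd)]
  simp only [pathWeight, hanti b a, hanti z]
  field_simp
  ring

theorem zipWith_rotate_prod {α F : Type*} [Field F] (p : α → α → F) (z a a' : α) (l : List α) :
    (List.zipWith (fun x y => (p x y)⁻¹) (a :: l ++ [z]) (l ++ [z] ++ [a'])).prod =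
      pathWeight p z (a :: l) * (p z a')⁻¹ := by
  induction l generalizing a with
  | nil => simp [pathWeight]
  | cons b l ih =>
    have := ih b
    simp only [List.cons_append, List.zipWith_cons_cons, List.prod_cons, pathWeight] at this ⊢
    rw [this, mul_assoc]

theorem prod_cyclic {α F : Type*} [Field F] (p : α → α → F) (l : List α) :
    ∏ m : Fin l.length, (p (l.get m) (l.get ⟨(m + 1) % l.length, Nat.mod_lt _ m.pos⟩))⁻¹ =
      (List.zipWith (fun x y => (p x y)⁻¹) l (l.rotate 1)).prod := by
  rw [← List.prod_ofFn]
  congr 1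
  apply List.ext_getElem
  · simp
  · intro m h1 h2
    simp [List.getElem_rotate]

theorem prod_cyclic_append_singleton {α F : Type*} [Field F] (p : α → α → F) (z : α) {γ : List α}
    (hγ : γ ≠ []) :
    ∏ m : Fin (γ ++ [z]).length, (p ((γ ++ [z]).get m)
      ((γ ++ [z]).get ⟨(m + 1) % (γ ++ [z]).length, Nat.mod_lt _ m.pos⟩))⁻¹ =
      pathWeight p z γ * (p z (γ.headD z))⁻¹ := by
  rw [prod_cyclic]
  cases γ with
  | nil => exact absurd rfl hγ
  | cons a l => simpa using zipWith_rotate_prod p z a a l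

/-- The bilinear form sending `u, v` to the determinant of `N` with the rows `u` and `v`
appended. -/
noncomputable def rowForm {F ι κ : Type*} [Field F] [Fintype ι] [DecidableEq ι]
    (N : Matrix ι κ F) (e : ι ⊕ Fin 2 ≃ κ) (u v : κ → F) : F :=
  ((Matrix.fromRows N (Matrix.of ![u, v])).submatrix id e).det

section rowForm

variable {F ι κ : Type*} [Field F] [Fintype ι] [DecidableEq ι]
  (N : Matrix ι κ F) (e : ι ⊕ Fin 2 ≃ κ)

theorem rowForm_swap (u v : κ → F) : rowForm N e u v = -rowForm N e v u := by
  have h := Matrix.det_permute (Equiv.swap (Sum.inr 0) (Sum.inr 1))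
    ((Matrix.fromRows N (Matrix.of ![v, u])).submatrix id e)
  rw [Equiv.Perm.sign_swap (by simp)] at h
  suffices hs : rowForm N e u v = _ by
    refine hs.trans (h.trans ?_)
    simp [rowForm]
  rw [rowForm]
  congr 1
  ext x y
  rcases x with x | x
  · simp [Equiv.swap_apply_of_ne_of_ne]
  · fin_cases x <;> simp

theorem rowForm_eq_det_updateRow (u w v : κ → F) :
    rowForm N e u v = (((Matrix.fromRows N (Matrix.of ![w, v])).submatrix id e).updateRow
      (Sum.inr 0) (u ∘ e)).det := by
  rw [rowForm]
  congr 1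
  ext x y
  rcases x with x | x
  · simp [Matrix.updateRow_apply]
  · fin_cases x <;> simp [Matrix.updateRow_apply]

theorem rowForm_add_left (u u' v : κ → F) :
    rowForm N e (u + u') v = rowForm N e u v + rowForm N e u' v := by
  rw [rowForm_eq_det_updateRow N e _ 0, rowForm_eq_det_updateRow N e u 0,
    rowForm_eq_det_updateRow N e u' 0, ← Matrix.det_updateRow_add]
  rfl

theorem rowForm_smul_left (c : F) (u v : κ → F) :
    rowForm N e (c • u) v = c * rowForm N e u v := by
  rw [rowForm_eq_det_updateRow N e _ 0, rowForm_eq_det_updateRow N e u 0,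
    ← Matrix.det_updateRow_smul]
  rfl

theorem rowForm_self (v : κ → F) : rowForm N e v v = 0 :=
  Matrix.det_zero_of_row_eq (i := Sum.inr 0) (j := Sum.inr 1) (by simp) (by ext; simp)

theorem rowForm_row_left (i : ι) (v : κ → F) : rowForm N e (N i) v = 0 :=
  Matrix.det_zero_of_row_eq (i := Sum.inl i) (j := Sum.inr 0) (by simp) (by ext; simp)

theorem rowForm_linear_combination_left (y : ι → F) (c d : F) (u v w : κ → F) :
    rowForm N e (∑ i, y i • N i + (c • u + d • v)) w =
      c * rowForm N e u w + d * rowForm N e v w := by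
  let L : (κ → F) →ₗ[F] F :=
    { toFun := fun u => rowForm N e u w
      map_add' := fun u u' => rowForm_add_left N e u u' w
      map_smul' := fun c u => rowForm_smul_left N e c u w }
  have h : L (∑ i, y i • N i + (c • u + d • v)) = c * L u + d * L v := by
    have hz : ∀ i, L (N i) = 0 := fun i => rowForm_row_left N e i w
    simp [hz]
  exact h

theorem rowForm_plucker (u v w x : κ → F) (h : rowForm N e u v ≠ 0) :
    rowForm N e w x * rowForm N e u v =
      rowForm N e w v * rowForm N e u x - rowForm N e w u * rowForm N e v x := by
  set A := (Matrix.fromRows N (Matrix.of ![u, v])).submatrix id e with hA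
  obtain ⟨y, hy⟩ : ∃ y, Matrix.vecMul y A = w ∘ e := by
    have hu : IsUnit A.det := isUnit_iff_ne_zero.2 h
    exact ⟨Matrix.vecMul (w ∘ e) A⁻¹, by
      rw [Matrix.vecMul_vecMul, Matrix.nonsing_inv_mul _ hu, Matrix.vecMul_one]⟩
  have hw : w = ∑ i, y (Sum.inl i) • N i + (y (Sum.inr 0) • u + y (Sum.inr 1) • v) := by
    ext j
    have := congrFun hy (e.symm j)
    simp [Matrix.vecMul, dotProduct, hA] at this
    simp [← this]
  generalize y (Sum.inr 0) = c at hw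
  generalize y (Sum.inr 1) = d at hw
  have key := fun t => rowForm_linear_combination_left N e (fun i => y (Sum.inl i)) c d u v t
  simp only [← hw] at key
  rw [key x, key u, key v, rowForm_self, rowForm_self, rowForm_swap N e v u]
  ring

variable [Fintype κ] [DecidableEq κ]

theorem det_submatrix_eq_sign_mul_rowForm (σ : Equiv.Perm κ) :
    (N.submatrix id fun c => σ (e (Sum.inl c))).det =
      ((Equiv.Perm.sign σ : ℤ) : F) *
        rowForm N e (Pi.single (σ (e (Sum.inr 0))) 1) (Pi.single (σ (e (Sum.inr 1))) 1) := by
  set A := Matrix.fromRows N (Matrix.of ![Pi.single (σ (e (Sum.inr 0))) 1,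
    Pi.single (σ (e (Sum.inr 1))) (1 : F)])
  have h := Matrix.det_permute' ((e.trans σ).trans e.symm) (A.submatrix id e)
  rw [Equiv.Perm.sign_trans_trans_symm] at h
  refine Eq.trans ?_ h
  have hb : (A.submatrix id e).submatrix id ((e.trans σ).trans e.symm) =
      Matrix.fromBlocks (N.submatrix id fun c => σ (e (Sum.inl c)))
        (N.submatrix id fun c => σ (e (Sum.inr c))) 0 1 := by
    ext x y
    rcases x with x | x <;> rcases y with y | y
    · simp [A]
    · simp [A]
    · fin_cases x <;> simp [A]
    · fin_cases x <;> fin_cases y <;> simp [A]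
  rw [hb, Matrix.det_fromBlocks_zero₂₁, Matrix.det_one, mul_one]

theorem rowForm_single_ne_zero
    (hminors : ∀ cols : ι → κ, Function.Injective cols → (N.submatrix id cols).det ≠ 0)
    {a b : κ} (hab : a ≠ b) : rowForm N e (Pi.single a 1) (Pi.single b 1) ≠ 0 := by
  obtain ⟨σ, h0, h1⟩ : ∃ σ : Equiv.Perm κ, σ (e (Sum.inr 0)) = a ∧ σ (e (Sum.inr 1)) = b := by
    have hne : e (Sum.inr 0) ≠ e (Sum.inr 1) := by simp
    refine ⟨(Equiv.swap (e (Sum.inr 0)) a).trans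
      (Equiv.swap (Equiv.swap (e (Sum.inr 0)) a (e (Sum.inr 1))) b), ?_, ?_⟩
    · rw [Equiv.trans_apply, Equiv.swap_apply_left, Equiv.swap_apply_of_ne_of_ne _ hab]
      intro h
      have h' := (Equiv.swap_apply_left (e (Sum.inr 0)) a).trans h
      exact hne ((Equiv.swap _ _).injective h')
    · simp
  intro h
  refine hminors (fun c => σ (e (Sum.inl c)))
    (σ.injective.comp (e.injective.comp Sum.inl_injective)) ?_
  rw [det_submatrix_eq_sign_mul_rowForm, h0, h1, h, mul_zero]

end rowForm

theorem listSign_append_singleton {γ : List ℕ} {z : ℕ} (hz : ∀ x ∈ γ, x ≤ z) :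
    listSign (γ ++ [z]) = listSign γ := by
  unfold listSign
  congr 1
  symm
  have hl : γ.length ≤ (γ ++ [z]).length := by simp
  refine Finset.card_bij (fun pq _ => (Fin.castLE hl pq.1, Fin.castLE hl pq.2)) ?_ ?_ ?_
  · rintro ⟨a, b⟩ h
    simpa [List.getElem_append_left] using h
  · rintro ⟨a, b⟩ _ ⟨c, d⟩ _ h
    simpa using h
  · rintro ⟨⟨a, ha⟩, ⟨b, hb⟩⟩ h
    simp only [Finset.mem_filter, Finset.mem_univ, true_and, Fin.mk_lt_mk, List.get_eq_getElem] at h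
    obtain ⟨h1, h2⟩ := h
    simp only [List.length_append, List.length_singleton] at ha hb
    have hb' : b < γ.length := by
      by_contra hcon
      obtain rfl : b = γ.length := by omega
      rw [List.getElem_concat_length rfl, List.getElem_append_left h1] at h2
      exact absurd h2 (not_lt.2 (hz _ (List.getElem_mem _)))
    refine ⟨(⟨a, h1.trans hb'⟩, ⟨b, hb'⟩), ?_, rfl⟩
    rw [List.getElem_append_left hb', List.getElem_append_left (h1.trans hb')] at h2
    simpa using ⟨h1, h2⟩

theorem listSign_eq_sign {n : ℕ} {l : List ℕ} (hl : l.length = n) (σ : Equiv.Perm (Fin n))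
    (hσ : ∀ j k, σ j < σ k ↔ l.get (j.cast hl.symm) < l.get (k.cast hl.symm)) :
    listSign l = Equiv.Perm.sign σ := by
  subst hl
  simp only [Fin.cast_eq_self] at hσ
  rw [Equiv.Perm.sign_eq_prod_prod_Ioi, Finset.prod_sigma', listSign, ← Finset.prod_const,
    Finset.prod_filter]
  rw [Fintype.prod_prod_type]
  simp only [Finset.prod_sigma, Units.coe_prod]
  refine Finset.prod_congr rfl fun a _ => ?_
  rw [← Finset.filter_lt_eq_Ioi, Finset.prod_filter]
  refine Finset.prod_congr rfl fun b _ => ?_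
  by_cases hab : a < b
  · have : l.get b < l.get a ↔ ¬ σ a < σ b := by
      rw [← hσ b a, not_lt]
      exact (lt_iff_le_and_ne.trans (and_iff_left (σ.injective.ne hab.ne')))
    rw [if_pos hab]
    by_cases h : σ a < σ b
    · rw [if_neg (fun h' => this.1 h'.2 h), if_pos h]; rfl
    · rw [if_pos ⟨hab, this.2 h⟩, if_neg h]; rfl
  · simp [hab]

theorem PTk_eq_prod_perm {F : Type*} [Field F] {k n : ℕ} [NeZero n] (hk : k ≤ n)
    (N : Matrix (Fin k) (Fin n) F) {l : List (Fin n)} (hl : l.length = n) (σ : Equiv.Perm (Fin n))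
    (hσ : ∀ j, σ j = l.get (j.cast hl.symm)) :
    PTk N l = ∏ m, (N.submatrix id fun c => σ (m + Fin.castLE hk c)).det⁻¹ := by
  unfold PTk Delta
  refine Fintype.prod_equiv (finCongr hl) _ _ fun m => ?_
  congr 3
  ext c
  rw [hσ]
  simp [Fin.val_add, hl]

/-- The constant relating the Parke-Taylor factor of a matrix to that of its dual form. -/
noncomputable def rotationSign (F : Type*) [Field F] (n : ℕ) [NeZero n] : F :=
  ∏ m : Fin n, ((Equiv.Perm.sign (Equiv.addLeft m) : ℤ) : F)⁻¹

theorem PTk_eq_prod_rowForm {F : Type*} [Field F] {k n : ℕ} [NeZero n] (hk : k + 2 = n)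
    (N : Matrix (Fin k) (Fin n) F) {l : List (Fin n)} (hl : l.length = n) (σ : Equiv.Perm (Fin n))
    (hσ : ∀ j, σ j = l.get (j.cast hl.symm)) :
    ((Equiv.Perm.sign σ : ℤ) : F) ^ n * PTk N l = rotationSign F n *
      ∏ m : Fin l.length, (rowForm N (finSumFinEquiv.trans (finCongr hk)) (Pi.single (l.get m) 1)
        (Pi.single (l.get ⟨(m + 1) % l.length, Nat.mod_lt _ m.pos⟩) 1))⁻¹ := by
  set e := finSumFinEquiv.trans (finCongr hk)
  rw [PTk_eq_prod_perm (by omega) N hl σ hσ]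
  have hdet : ∀ m : Fin n, (N.submatrix id fun c => σ (m + Fin.castLE (by omega) c)).det⁻¹ =
      ((Equiv.Perm.sign σ : ℤ) : F)⁻¹ * (((Equiv.Perm.sign (Equiv.addLeft m) : ℤ) : F)⁻¹ *
        (rowForm N e (Pi.single (σ (m + ⟨k, by omega⟩)) 1)
          (Pi.single (σ (m + ⟨k, by omega⟩ + 1)) 1))⁻¹) := by
    intro m
    have h := det_submatrix_eq_sign_mul_rowForm N e ((Equiv.addLeft m).trans σ)
    have h0 : e (Sum.inr 0) = ⟨k, by omega⟩ := by ext; simp [e]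
    have h1 : e (Sum.inr 1) = ⟨k, by omega⟩ + 1 := by
      ext
      rw [Fin.val_add, Fin.val_one', Nat.add_mod_mod, Nat.mod_eq_of_lt (by simp; omega)]
      simp [e]
    have hc : ∀ c, e (Sum.inl c) = Fin.castLE (by omega) c := fun c => by ext; simp [e]
    rw [Equiv.Perm.sign_trans] at h
    simp only [Equiv.trans_apply, Equiv.coe_addLeft, h0, h1, hc, ← add_assoc] at h
    rw [h, ← mul_inv, ← mul_inv]
    push_cast
    ring
  simp only [hdet, Finset.prod_mul_distrib, Finset.prod_const, Finset.card_univ, Fintype.card_fin]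
  rw [← mul_assoc, ← mul_pow, mul_inv_cancel₀, one_pow, one_mul]
  · congr 1
    rw [Fintype.prod_equiv (Equiv.addRight (⟨k, by omega⟩ : Fin n)) _
      (fun m => (rowForm N e (Pi.single (σ m) 1) (Pi.single (σ (m + 1)) 1))⁻¹) (fun m => by simp)]
    refine (Fintype.prod_equiv (finCongr hl) _ _ fun m => ?_).symm
    simp only [hσ]
    congr 4
    ext
    simp [Fin.val_add, hl]
  · rcases Int.units_eq_one_or (Equiv.Perm.sign σ) with h | h <;> simp [h]

/-- The degenerated Kleiss-Kuijf relation for `k = n - 2`: for an `(n-2) × n` matrix all of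
whose maximal minors are nonzero, `∑_γ sgn(γ)^n PT^(n-2)(γ, n) = 0`, the sum running over all
shuffles `γ` of `(1, …, i)` and `(i+1, …, n-1)`.  Labels `1, …, n` correspond to the columns
`0, …, n-1` of the matrix. -/
theorem stmt3 {F : Type*} [Field F] (n : ℕ) (hn : 4 ≤ n) (i : ℕ) (hi1 : 1 ≤ i)
    (hi2 : i ≤ n - 2) (N : Matrix (Fin (n - 2)) (Fin n) F)
    (hminors : ∀ cols : Fin (n - 2) → Fin n, Function.Injective cols →
      (N.submatrix id cols).det ≠ 0) :
    ∑ γ ∈ (List.range' 1 i ++ List.range' (i + 1) (n - 1 - i)).permutations.toFinset.filter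
        (fun γ => List.Sublist (List.range' 1 i) γ ∧
          List.Sublist (List.range' (i + 1) (n - 1 - i)) γ),
      (listSign γ : F) ^ n *
        PTk N ((γ ++ [n]).map fun a => (⟨(a - 1) % n, Nat.mod_lt _ (by omega)⟩ : Fin n)) = 0 := by
  have : NeZero n := ⟨by omega⟩
  set f : ℕ → Fin n := fun a => ⟨(a - 1) % n, Nat.mod_lt _ (by omega)⟩ with hf
  have hfv : ∀ a, 1 ≤ a → a ≤ n → (f a : ℕ) = a - 1 := fun a h1 h2 =>
    Nat.mod_eq_of_lt (by omega)
  have hk : n - 2 + 2 = n := by omega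
  set e := finSumFinEquiv.trans (finCongr hk)
  set q : Fin n → Fin n → F := fun a b => rowForm N e (Pi.single a 1) (Pi.single b 1) with hq
  have hqne : ∀ a b, a ≠ b → q a b ≠ 0 := fun a b hab => rowForm_single_ne_zero N e hminors hab
  have hanti : ∀ a b, q a b = -q b a := fun a b => rowForm_swap N e _ _
  have hself : ∀ a, q a a = 0 := fun a => rowForm_self N e _
  have hpl : ∀ z a b c, q c z * q a b = q c b * q a z - q c a * q b z := by
    intro z a b c
    by_cases hab : a = b
    · subst hab; rw [hself]; ring
    · exact rowForm_plucker N e _ _ _ _ (hqne a b hab)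
  have hrange : List.range' 1 i ++ List.range' (i + 1) (n - 1 - i) = List.range' 1 (n - 1) := by
    rw [add_comm i 1, List.range'_append_1]
    congr 1
    omega
  have hnd : (n :: (List.range' 1 i ++ List.range' (i + 1) (n - 1 - i))).Nodup := by
    rw [hrange, List.nodup_cons]
    refine ⟨?_, List.nodup_range'⟩
    rw [List.mem_range'_1]
    omega
  have hmem : ∀ x ∈ n :: (List.range' 1 i ++ List.range' (i + 1) (n - 1 - i)),
      1 ≤ x ∧ x ≤ n := by
    intro x hx
    rw [hrange, List.mem_cons, List.mem_range'_1] at hx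
    omega
  have hterm : ∀ γ ∈ shuffles (List.range' 1 i) (List.range' (i + 1) (n - 1 - i)),
      (listSign γ : F) ^ n * PTk N ((γ ++ [n]).map f) = rotationSign F n *
        (pathWeight (fun a b => q (f a) (f b)) n γ * (q (f n) (f (γ.headD n)))⁻¹) := by
    intro γ hγ
    have hperm := (mem_shuffles.1 hγ).1
    have hperm' : (γ ++ [n]).Perm (n :: (List.range' 1 i ++ List.range' (i + 1) (n - 1 - i))) :=
      (List.perm_append_singleton n γ).trans (hperm.cons n)
    have hlen : (γ ++ [n]).length = n := by
      rw [hperm'.length_eq, hrange]; simp; omega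
    have hmem' : ∀ x ∈ γ ++ [n], 1 ≤ x ∧ x ≤ n := fun x hx => hmem x (hperm'.subset hx)
    have hγ0 : γ ≠ [] := by
      rintro rfl
      simp at hlen
      omega
    have hlt : ∀ x ∈ γ ++ [n], ∀ y ∈ γ ++ [n], (f x < f y ↔ x < y) := by
      intro x hx y hy
      have hx' := hmem' x hx
      have hy' := hmem' y hy
      rw [Fin.lt_def, hfv x hx'.1 hx'.2, hfv y hy'.1 hy'.2]
      omega
    have hinj : Function.Injective fun j : Fin n => f ((γ ++ [n]).get (j.cast hlen.symm)) := by
      intro j k hjk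
      have hj := hmem' _ (List.get_mem (γ ++ [n]) (j.cast hlen.symm))
      have hk := hmem' _ (List.get_mem (γ ++ [n]) (k.cast hlen.symm))
      have h := congrArg Fin.val hjk
      simp only at h
      rw [hfv _ hj.1 hj.2, hfv _ hk.1 hk.2] at h
      have h' := List.nodup_iff_injective_get.1 (hperm'.nodup_iff.2 hnd)
        (show (γ ++ [n]).get (j.cast hlen.symm) = (γ ++ [n]).get (k.cast hlen.symm) by omega)
      simpa using h'
    let σ : Equiv.Perm (Fin n) := Equiv.ofBijective _ (Finite.injective_iff_bijective.1 hinj)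
    have hσ : ∀ j, σ j = f ((γ ++ [n]).get (j.cast hlen.symm)) := fun j => rfl
    rw [← listSign_append_singleton (z := n) fun x hx => (hmem' x (by simp [hx])).2,
      listSign_eq_sign hlen σ fun j k => by
        rw [hσ, hσ]; exact hlt _ (List.get_mem _ _) _ (List.get_mem _ _),
      PTk_eq_prod_rowForm hk N ((List.length_map f).trans hlen) σ fun j => by
        rw [hσ]; simp [-List.map_append],
      ← prod_cyclic_append_singleton (fun a b => q (f a) (f b)) n hγ0]
    congr 1
    refine Fintype.prod_equiv (finCongr (List.length_map f)) _ _ fun m => ?_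
    simp [hq, e, -List.map_append]
  refine (Finset.sum_congr rfl hterm).trans ?_
  rw [← Finset.mul_sum]
  obtain ⟨ρ, hρ⟩ : ∃ ρ, List.range' 1 i = 1 :: ρ := by
    obtain ⟨j, rfl⟩ := Nat.exists_eq_add_of_le' hi1
    exact ⟨_, List.range'_succ⟩
  obtain ⟨ω, hω⟩ : ∃ ω, List.range' (i + 1) (n - 1 - i) = (i + 1) :: ω := by
    obtain ⟨j, hj⟩ : ∃ j, n - 1 - i = j + 1 := ⟨n - 2 - i, by omega⟩
    rw [hj]
    exact ⟨_, List.range'_succ⟩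
  rw [hρ, hω] at hnd hmem ⊢
  rw [sum_shuffles_closed_pathWeight (p := fun a b => q (f a) (f b)) (fun a b => hanti _ _)
    (fun a b c => hpl _ _ _ _) ?_ hnd, mul_zero]
  intro x hx y hy hxy
  refine hqne _ _ fun h => hxy ?_
  have hx' := hmem x hx
  have hy' := hmem y hy
  have h' := congrArg Fin.val h
  rw [hfv x hx'.1 hx'.2, hfv y hy'.1 hy'.2] at h'
  omega
end

section
/- Let $P : (\mathbb{C}^3)^6 \to \mathbb{C}$ be a $\mathbb{C}$-linear combination of products $\Delta_{J_1}\Delta_{J_2}\Delta_{J_3}\Delta_{J_4}$ of four $3\times 3$ determinants $\Delta_{abc} = \det(v_a,v_b,v_c)$, where $J_1,\dots,J_4$ are triples of indices from $\{1,\dots,6\}$ such that each index $1,\dots,6$ occurs exactly twice among $J_1,\dots,J_4$. Suppose $P(v_1,\dots,v_6) = 0$ whenever there exists a partition $\{a,b,c\} \sqcup \{d,e,f\} = \{1,\dots,6\}$ with $\Delta_{abc}(v) = 0$ and $\Delta_{def}(v) = 0$. Then $P$ is a scalar multiple of the Veronese polynomial $V = \Delta_{123}\Delta_{345}\Delta_{561}\Delta_{246}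 - \Delta_{234}\Delta_{456}\Delta_{612}\Delta_{351}$. -/
/-- `Δ_{abc}`: the determinant of the `3 × 3` matrix whose columns are `v a`, `v b`, `v c`. -/
def Δ3 {N : ℕ} (v : Fin N → Fin 3 → ℂ) (a b c : Fin N) : ℂ :=
  Matrix.det (Matrix.of fun i j => ![v a, v b, v c] j i)

/-- The Veronese polynomial `V = Δ₁₂₃Δ₃₄₅Δ₅₆₁Δ₂₄₆ - Δ₂₃₄Δ₄₅₆Δ₆₁₂Δ₃₅₁`
(labels `1, …, 6` correspond to indices `0, …, 5`). -/
def Ver (v : Fin 6 → Fin 3 → ℂ) : ℂ :=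
  Δ3 v 0 1 2 * Δ3 v 2 3 4 * Δ3 v 4 5 0 * Δ3 v 1 3 5 -
    Δ3 v 1 2 3 * Δ3 v 3 4 5 * Δ3 v 5 0 1 * Δ3 v 2 4 0


section Determinants

lemma Δ3_mulVec {N : ℕ} (M : Matrix (Fin 3) (Fin 3) ℂ) (v : Fin N → Fin 3 → ℂ) (a b c : Fin N) :
    Δ3 (fun i => M.mulVec (v i)) a b c = M.det * Δ3 v a b c := by
  simp only [Δ3, ← Matrix.det_mul]
  congr 1
  ext i j
  fin_cases j <;> rfl

lemma Δ3_smul {N : ℕ} (s : Fin N → ℂ) (v : Fin N → Fin 3 → ℂ) (a b c : Fin N) :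
    Δ3 (fun i => s i • v i) a b c = s a * s b * s c * Δ3 v a b c := by
  simp [Δ3, Matrix.det_fin_three]
  ring

lemma continuous_Δ3 {N : ℕ} (a b c : Fin N) :
    Continuous fun v : Fin N → Fin 3 → ℂ => Δ3 v a b c := by
  simp only [Δ3, Matrix.det_fin_three, Matrix.of_apply, Matrix.cons_val]
  fun_prop

lemma continuous_Ver : Continuous Ver := by
  have := @continuous_Δ3 6
  unfold Ver
  fun_prop

lemma Ver_mulVec (M : Matrix (Fin 3) (Fin 3) ℂ) (v : Fin 6 → Fin 3 → ℂ) :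
    Ver (fun i => M.mulVec (v i)) = M.det ^ 4 * Ver v := by
  simp only [Ver, Δ3_mulVec]
  ring

end Determinants

/-- The six vectors consisting of the standard basis followed by `A 0`, `A 1`, `A 2`, with entries
in any commutative ring. -/
def frame {R : Type*} [CommRing R] (A : Fin 3 → Fin 3 → R) : Fin 6 → Fin 3 → R :=
  ![![1, 0, 0], ![0, 1, 0], ![0, 0, 1], A 0, A 1, A 2]

lemma map_frame {R S : Type*} [CommRing R] [CommRing S] (f : R →+* S) (A : Fin 3 → Fin 3 → R)
    (i : Fin 6) (j : Fin 3) : f (frame A i j) = frame (fun k l => f (A k l)) i j := by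
  fin_cases i <;> fin_cases j <;> simp [frame]

lemma frame_scale (A : Fin 3 → Fin 3 → ℂ) (r t : Fin 3 → ℂ) (ht : ∀ l, t l ≠ 0) :
    frame (fun k l => r k * t l * A k l) =
      fun i => (![(t 0)⁻¹, (t 1)⁻¹, (t 2)⁻¹, r 0, r 1, r 2] : Fin 6 → ℂ) i •
        (Matrix.diagonal t).mulVec (frame A i) := by
  ext i j
  fin_cases i <;> fin_cases j <;> simp [frame, Matrix.mulVec_diagonal, ht, mul_assoc]

lemma eq_mulVec_frame (v : Fin 6 → Fin 3 → ℂ) (M : Matrix (Fin 3) (Fin 3) ℂ)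
    (hM : M = Matrix.of fun i j => ![v 0, v 1, v 2] j i) (hdet : M.det ≠ 0) :
    v = fun i => M.mulVec (frame (fun k => M⁻¹.mulVec (![v 3, v 4, v 5] k)) i) := by
  have h (w : Fin 3 → ℂ) : M.mulVec (M⁻¹.mulVec w) = w := by
    rw [Matrix.mulVec_mulVec, Matrix.mul_nonsing_inv _ hdet.isUnit, Matrix.one_mulVec]
  funext i
  fin_cases i <;> simp [frame, h] <;>
    · ext j
      simp [hM, Matrix.mulVec, dotProduct, Fin.sum_univ_three]

namespace MvPolynomial

variable {σ : Type*} [Fintype σ]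

lemma coeff_bind₁_C_mul_X {R : Type*} [CommRing R] (s : σ → R) (F : MvPolynomial σ R)
    (m : σ →₀ ℕ) :
    coeff m (bind₁ (fun i => C (s i) * X i) F) = (∏ i, s i ^ m i) * coeff m F := by
  classical
  induction F using MvPolynomial.induction_on' with
  | monomial u a =>
    have h : bind₁ (fun i => C (s i) * X i) (monomial u a) =
        monomial u ((∏ i, s i ^ u i) * a) := by
      rw [bind₁_monomial, ← Finsupp.prod, Finsupp.prod_fintype _ _ fun _ => pow_zero _,
        monomial_eq, Finsupp.prod_fintype _ _ fun _ => pow_zero _]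
      simp only [mul_pow, Finset.prod_mul_distrib, map_mul, map_prod, map_pow]
      ring
    rw [h, coeff_monomial, coeff_monomial]
    split_ifs with hu
    · rw [hu]
    · simp
  | add p q hp hq => simp only [map_add, coeff_add, hp, hq, mul_add]

lemma prod_pow_eq_of_eval_scale {R : Type*} [CommRing R] [IsDomain R] [Infinite R]
    {F : MvPolynomial σ R} {s : σ → R} {a : R}
    (h : ∀ x, eval (fun i => s i * x i) F = a * eval x F) {m : σ →₀ ℕ} (hm : coeff m F ≠ 0) :
    ∏ i, s i ^ m i = a := by
  have key : bind₁ (fun i => C (s i) * X i) F = C a * F := by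
    refine MvPolynomial.funext fun x => ?_
    rw [eval_mul, eval_C, ← h, ← aeval_eq_eval, ← aeval_eq_eval, aeval_bind₁]
    simp
  have hc := congrArg (coeff m) key
  rw [coeff_bind₁_C_mul_X, coeff_C_mul] at hc
  exact mul_right_cancel₀ hm hc

end MvPolynomial

/-- The `3 × 3` matrices of natural numbers all of whose row and column sums are `2`. -/
def sumTwoMatrices : Fin 21 → Fin 3 → Fin 3 → ℕ :=
  ![![![0, 0, 2], ![0, 2, 0], ![2, 0, 0]], ![![0, 0, 2], ![2, 0, 0], ![0, 2, 0]],
    ![![0, 2, 0], ![0, 0, 2], ![2, 0, 0]], ![![0, 2, 0], ![2, 0, 0], ![0, 0, 2]],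
    ![![2, 0, 0], ![0, 0, 2], ![0, 2, 0]], ![![2, 0, 0], ![0, 2, 0], ![0, 0, 2]],
    ![![0, 0, 2], ![1, 1, 0], ![1, 1, 0]], ![![0, 1, 1], ![0, 1, 1], ![2, 0, 0]],
    ![![0, 1, 1], ![2, 0, 0], ![0, 1, 1]], ![![0, 2, 0], ![1, 0, 1], ![1, 0, 1]],
    ![![1, 0, 1], ![0, 2, 0], ![1, 0, 1]], ![![1, 0, 1], ![1, 0, 1], ![0, 2, 0]],
    ![![1, 1, 0], ![0, 0, 2], ![1, 1, 0]], ![![1, 1, 0], ![1, 1, 0], ![0, 0, 2]],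
    ![![2, 0, 0], ![0, 1, 1], ![0, 1, 1]], ![![0, 1, 1], ![1, 0, 1], ![1, 1, 0]],
    ![![0, 1, 1], ![1, 1, 0], ![1, 0, 1]], ![![1, 0, 1], ![0, 1, 1], ![1, 1, 0]],
    ![![1, 0, 1], ![1, 1, 0], ![0, 1, 1]], ![![1, 1, 0], ![0, 1, 1], ![1, 0, 1]],
    ![![1, 1, 0], ![1, 0, 1], ![0, 1, 1]]]

lemma exists_sumTwoMatrices_eq (m : Fin 3 → Fin 3 → ℕ) (hrow : ∀ k, ∑ l, m k l = 2)
    (hcol : ∀ l, ∑ k, m k l = 2) : ∃ i, sumTwoMatrices i = m := by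
  have key : ∀ a b d e : Fin 3, a.1 + b.1 ≤ 2 → d.1 + e.1 ≤ 2 → a.1 + d.1 ≤ 2 → b.1 + e.1 ≤ 2 →
      2 ≤ a.1 + b.1 + d.1 + e.1 → ∃ i, sumTwoMatrices i =
        ![![a.1, b.1, 2 - a.1 - b.1], ![d.1, e.1, 2 - d.1 - e.1],
          ![2 - a.1 - d.1, 2 - b.1 - e.1, a.1 + b.1 + d.1 + e.1 - 2]] := by
    decide
  have r0 := hrow 0
  have r1 := hrow 1
  have r2 := hrow 2
  have c0 := hcol 0
  have c1 := hcol 1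
  have c2 := hcol 2
  simp only [Fin.sum_univ_three] at r0 r1 r2 c0 c1 c2
  obtain ⟨i, hi⟩ := key ⟨m 0 0, by omega⟩ ⟨m 0 1, by omega⟩ ⟨m 1 0, by omega⟩ ⟨m 1 1, by omega⟩
    (by grind) (by grind) (by grind) (by grind) (by grind)
  refine ⟨i, hi.trans ?_⟩
  funext k l
  fin_cases k <;> fin_cases l <;> simp <;> omega

/-- A polynomial in the entries of a `3 × 3` matrix that has degree two in every row and in every
column is a combination of the monomials with row and column sums `2`. -/
lemma exists_eq_sum_of_scale (F : MvPolynomial (Fin 3 × Fin 3) ℂ)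
    (hF : ∀ (r t : Fin 3 → ℂ) (x : Fin 3 × Fin 3 → ℂ), (∀ l, t l ≠ 0) →
      MvPolynomial.eval (fun i => r i.1 * t i.2 * x i) F =
        (∏ k, r k) ^ 2 * (∏ l, t l) ^ 2 * MvPolynomial.eval x F) :
    ∃ c : Fin 21 → ℂ, ∀ x, MvPolynomial.eval x F =
      ∑ i, c i * ∏ k, ∏ l, x (k, l) ^ sumTwoMatrices i k l := by
  have hpow {n : ℕ} (h : (2 : ℂ) ^ n = 2 ^ 2) : n = 2 :=
    Nat.pow_right_injective le_rfl (by exact_mod_cast h)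
  have hcol (m) (hm : MvPolynomial.coeff m F ≠ 0) (l : Fin 3) : ∑ k, m (k, l) = 2 := by
    have h := MvPolynomial.prod_pow_eq_of_eval_scale
      (hF 1 (Function.update 1 l 2) · (by intro j; by_cases j = l <;> simp_all)) hm
    apply hpow
    rw [Fintype.prod_prod_type_right, Finset.prod_eq_single l] at h
    · simpa [Finset.prod_pow_eq_pow_sum, Finset.prod_update_of_mem] using h
    · intro j _ hj
      simp [hj]
    · simp
  have hrow (m) (hm : MvPolynomial.coeff m F ≠ 0) (k : Fin 3) : ∑ l, m (k, l) = 2 := by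
    have h := MvPolynomial.prod_pow_eq_of_eval_scale
      (hF (Function.update 1 k 2) 1 · (by simp)) hm
    apply hpow
    rw [Fintype.prod_prod_type, Finset.prod_eq_single k] at h
    · simpa [Finset.prod_pow_eq_pow_sum, Finset.prod_update_of_mem] using h
    · intro j _ hj
      simp [hj]
    · simp
  have hmem : (fun x => MvPolynomial.eval x F) ∈ Submodule.span ℂ (Set.range
      fun (i : Fin 21) (x : Fin 3 × Fin 3 → ℂ) => ∏ k, ∏ l, x (k, l) ^ sumTwoMatrices i k l) := by
    have hsum : (fun x => MvPolynomial.eval x F) = ∑ m ∈ F.support,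
        F.coeff m • fun x : Fin 3 × Fin 3 → ℂ => ∏ k, ∏ l, x (k, l) ^ m (k, l) := by
      funext x
      simp [MvPolynomial.eval_eq', Fintype.prod_prod_type]
    rw [hsum]
    refine Submodule.sum_mem _ fun m hm => Submodule.smul_mem _ _ (Submodule.subset_span ?_)
    rw [MvPolynomial.mem_support_iff] at hm
    obtain ⟨i, hi⟩ := exists_sumTwoMatrices_eq (fun k l => m (k, l)) (hrow m hm) (hcol m hm)
    exact ⟨i, by simp [hi]⟩
  obtain ⟨c, hc⟩ := (Submodule.mem_span_range_iff_exists_fun ℂ).1 hmem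
  exact ⟨c, fun x => by simpa using (congrFun hc x).symm⟩


section Combination

variable (coef : (Fin 4 → Fin 3 → Fin 6) → ℂ)

/-- The linear combination of fourfold products of determinants with coefficients `coef`. -/
noncomputable def combΔ3 (v : Fin 6 → Fin 3 → ℂ) : ℂ :=
  ∑ T : Fin 4 → Fin 3 → Fin 6, coef T * ∏ t : Fin 4, Δ3 v (T t 0) (T t 1) (T t 2)

lemma continuous_combΔ3 : Continuous (combΔ3 coef) := by
  have := @continuous_Δ3 6
  unfold combΔ3
  fun_prop

lemma combΔ3_mulVec (M : Matrix (Fin 3) (Fin 3) ℂ) (v : Fin 6 → Fin 3 → ℂ) :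
    combΔ3 coef (fun i => M.mulVec (v i)) = M.det ^ 4 * combΔ3 coef v := by
  simp only [combΔ3, Δ3_mulVec, Finset.mul_sum, Finset.prod_mul_distrib, Finset.prod_const,
    Finset.card_univ, Fintype.card_fin]
  exact Finset.sum_congr rfl fun T _ => by ring

variable {coef}

lemma combΔ3_smul
    (hcoef : ∀ T : Fin 4 → Fin 3 → Fin 6, coef T ≠ 0 → ∀ idx : Fin 6,
      ((Finset.univ : Finset (Fin 4 × Fin 3)).filter (fun ts => T ts.1 ts.2 = idx)).card = 2)
    (s : Fin 6 → ℂ) (v : Fin 6 → Fin 3 → ℂ) :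
    combΔ3 coef (fun i => s i • v i) = (∏ i, s i) ^ 2 * combΔ3 coef v := by
  simp only [combΔ3, Δ3_smul, Finset.mul_sum, Finset.prod_mul_distrib]
  refine Finset.sum_congr rfl fun T _ => ?_
  by_cases hT : coef T = 0
  · simp [hT]
  have h : ∏ ts : Fin 4 × Fin 3, s (T ts.1 ts.2) = (∏ i, s i) ^ 2 := by
    rw [← Finset.prod_fiberwise Finset.univ (fun ts : Fin 4 × Fin 3 => T ts.1 ts.2),
      ← Finset.prod_pow]
    refine Finset.prod_congr rfl fun i _ => ?_
    rw [← hcoef T hT i, ← Finset.prod_const]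
    exact Finset.prod_congr rfl fun ts hts => by rw [(Finset.mem_filter.1 hts).2]
  rw [Fintype.prod_prod_type] at h
  simp only [Fin.prod_univ_three, Finset.prod_mul_distrib] at h
  rw [h]
  ring

variable (coef) in
/-- `combΔ3` on frames, as a polynomial in the entries of the last three vectors. -/
noncomputable def framePoly : MvPolynomial (Fin 3 × Fin 3) ℂ :=
  ∑ T : Fin 4 → Fin 3 → Fin 6, MvPolynomial.C (coef T) * ∏ t : Fin 4, Matrix.det
    (Matrix.of fun i j => frame (fun k l => MvPolynomial.X (k, l)) (T t j) i)

set_option maxRecDepth 4000 in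
lemma eval_framePoly (x : Fin 3 × Fin 3 → ℂ) :
    MvPolynomial.eval x (framePoly coef) = combΔ3 coef (frame fun k l => x (k, l)) := by
  simp only [framePoly, combΔ3, Δ3, map_sum, map_mul, map_prod, MvPolynomial.eval_C,
    RingHom.map_det]
  refine Finset.sum_congr rfl fun T _ => congrArg _ <| Finset.prod_congr rfl fun t _ => ?_
  congr 1
  ext i j
  simp only [RingHom.mapMatrix_apply, Matrix.map_apply, Matrix.of_apply, map_frame,
    MvPolynomial.eval_X]
  fin_cases j <;> rfl

lemma exists_combΔ3_frame_eq_sum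
    (hcoef : ∀ T : Fin 4 → Fin 3 → Fin 6, coef T ≠ 0 → ∀ idx : Fin 6,
      ((Finset.univ : Finset (Fin 4 × Fin 3)).filter (fun ts => T ts.1 ts.2 = idx)).card = 2) :
    ∃ c : Fin 21 → ℂ, ∀ A, combΔ3 coef (frame A) =
      ∑ i, c i * ∏ k, ∏ l, A k l ^ sumTwoMatrices i k l := by
  obtain ⟨c, hc⟩ := exists_eq_sum_of_scale (framePoly coef) fun r t x ht => by
    simp only [eval_framePoly]
    rw [frame_scale (fun k l => x (k, l)) r t ht, combΔ3_smul hcoef, combΔ3_mulVec,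
      Matrix.det_diagonal]
    have h0 := ht 0
    have h1 := ht 1
    have h2 := ht 2
    simp only [Fin.prod_univ_succ, Matrix.cons_val_zero, Matrix.cons_val_succ,
      Finset.univ_eq_empty, Finset.prod_empty]
    simp
    field_simp
  exact ⟨c, fun A => by simpa [eval_framePoly] using hc fun i => A i.1 i.2⟩

end Combination

lemma Δ3_frame_eq_zero (A : Fin 3 → Fin 3 → ℂ) (k l : Fin 3) (h0 : A k l = 0)
    (h1 : A (k + 1) (l + 1) * A (k + 2) (l + 2) = A (k + 1) (l + 2) * A (k + 2) (l + 1)) :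
    ∃ a b c d e f : Fin 6, ({a, b, c, d, e, f} : Finset (Fin 6)) = Finset.univ ∧
      Δ3 (frame A) a b c = 0 ∧ Δ3 (frame A) d e f = 0 := by
  refine ⟨(l + 1).castAdd 3, (l + 2).castAdd 3, k.natAdd 3, l.castAdd 3, (k + 1).natAdd 3,
    (k + 2).natAdd 3, by clear h0 h1; revert k l; decide, ?_, ?_⟩
  · fin_cases k <;> fin_cases l <;> simpa [Δ3, frame, Matrix.det_fin_three] using h0
  · fin_cases k <;> fin_cases l <;> simp [Δ3, frame, Matrix.det_fin_three] at h1 ⊢ <;>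
      linear_combination h1

lemma exists_eq_mul_Ver_frame (c : Fin 21 → ℂ)
    (hc : ∀ (A : Fin 3 → Fin 3 → ℂ) (k l : Fin 3), A k l = 0 →
      A (k + 1) (l + 1) * A (k + 2) (l + 2) = A (k + 1) (l + 2) * A (k + 2) (l + 1) →
      ∑ i, c i * ∏ k, ∏ l, A k l ^ sumTwoMatrices i k l = 0) :
    ∃ a, ∀ A : Fin 3 → Fin 3 → ℂ,
      ∑ i, c i * ∏ k, ∏ l, A k l ^ sumTwoMatrices i k l = a * Ver (frame A) := by
  have expand (A : Fin 3 → Fin 3 → ℂ) : ∑ i, c i * ∏ k, ∏ l, A k l ^ sumTwoMatrices i k l =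
      c 0 * (A 0 2 ^ 2 * A 1 1 ^ 2 * A 2 0 ^ 2) +
      c 1 * (A 0 2 ^ 2 * A 1 0 ^ 2 * A 2 1 ^ 2) +
      c 2 * (A 0 1 ^ 2 * A 1 2 ^ 2 * A 2 0 ^ 2) +
      c 3 * (A 0 1 ^ 2 * A 1 0 ^ 2 * A 2 2 ^ 2) +
      c 4 * (A 0 0 ^ 2 * A 1 2 ^ 2 * A 2 1 ^ 2) +
      c 5 * (A 0 0 ^ 2 * A 1 1 ^ 2 * A 2 2 ^ 2) +
      c 6 * (A 0 2 ^ 2 * A 1 0 * A 1 1 * A 2 0 * A 2 1) +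
      c 7 * (A 0 1 * A 0 2 * A 1 1 * A 1 2 * A 2 0 ^ 2) +
      c 8 * (A 0 1 * A 0 2 * A 1 0 ^ 2 * A 2 1 * A 2 2) +
      c 9 * (A 0 1 ^ 2 * A 1 0 * A 1 2 * A 2 0 * A 2 2) +
      c 10 * (A 0 0 * A 0 2 * A 1 1 ^ 2 * A 2 0 * A 2 2) +
      c 11 * (A 0 0 * A 0 2 * A 1 0 * A 1 2 * A 2 1 ^ 2) +
      c 12 * (A 0 0 * A 0 1 * A 1 2 ^ 2 * A 2 0 * A 2 1) +
      c 13 * (A 0 0 * A 0 1 * A 1 0 * A 1 1 * A 2 2 ^ 2) +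
      c 14 * (A 0 0 ^ 2 * A 1 1 * A 1 2 * A 2 1 * A 2 2) +
      c 15 * (A 0 1 * A 0 2 * A 1 0 * A 1 2 * A 2 0 * A 2 1) +
      c 16 * (A 0 1 * A 0 2 * A 1 0 * A 1 1 * A 2 0 * A 2 2) +
      c 17 * (A 0 0 * A 0 2 * A 1 1 * A 1 2 * A 2 0 * A 2 1) +
      c 18 * (A 0 0 * A 0 2 * A 1 0 * A 1 1 * A 2 1 * A 2 2) +
      c 19 * (A 0 0 * A 0 1 * A 1 1 * A 1 2 * A 2 0 * A 2 2) +
      c 20 * (A 0 0 * A 0 1 * A 1 0 * A 1 2 * A 2 1 * A 2 2) := by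
    simp [Fin.sum_univ_succ, Fin.prod_univ_three, sumTwoMatrices]
    ring
  simp only [expand] at hc ⊢
  have h0 : c 0 = 0 := by
    simpa using hc ![![0, 0, 1], ![0, 1, 0], ![1, 0, 0]] 0 0 (by simp) (by simp)
  have h1 : c 1 = 0 := by
    simpa using hc ![![0, 0, 1], ![1, 0, 0], ![0, 1, 0]] 0 0 (by simp) (by simp)
  have h2 : c 2 = 0 := by
    simpa using hc ![![0, 1, 0], ![0, 0, 1], ![1, 0, 0]] 0 0 (by simp) (by simp)
  have h3 : c 3 = 0 := by
    simpa using hc ![![0, 1, 0], ![1, 0, 0], ![0, 0, 1]] 0 0 (by simp) (by simp)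
  have h4 : c 4 = 0 := by
    simpa using hc ![![1, 0, 0], ![0, 0, 1], ![0, 1, 0]] 0 1 (by simp) (by simp)
  have h5 : c 5 = 0 := by
    simpa using hc ![![1, 0, 0], ![0, 1, 0], ![0, 0, 1]] 0 1 (by simp) (by simp)
  have h6 : c 6 = 0 := by
    simpa [h0, h1] using hc ![![0, 0, 1], ![1, 1, 0], ![1, 1, 0]] 0 0 (by simp) (by simp)
  have h7 : c 7 = 0 := by
    simpa [h0, h2] using hc ![![0, 1, 1], ![0, 1, 1], ![1, 0, 0]] 0 0 (by simp) (by simp)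
  have h8 : c 8 = 0 := by
    simpa [h1, h3] using hc ![![0, 1, 1], ![1, 0, 0], ![0, 1, 1]] 0 0 (by simp) (by simp)
  have h9 : c 9 = 0 := by
    simpa [h2, h3] using hc ![![0, 1, 0], ![1, 0, 1], ![1, 0, 1]] 0 0 (by simp) (by simp)
  have h10 : c 10 = 0 := by
    simpa [h0, h5] using hc ![![1, 0, 1], ![0, 1, 0], ![1, 0, 1]] 0 1 (by simp) (by simp)
  have h11 : c 11 = 0 := by
    simpa [h1, h4] using hc ![![1, 0, 1], ![1, 0, 1], ![0, 1, 0]] 0 1 (by simp) (by simp)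
  have h12 : c 12 = 0 := by
    simpa [h2, h4] using hc ![![1, 1, 0], ![0, 0, 1], ![1, 1, 0]] 0 2 (by simp) (by simp)
  have h13 : c 13 = 0 := by
    simpa [h3, h5] using hc ![![1, 1, 0], ![1, 1, 0], ![0, 0, 1]] 0 2 (by simp) (by simp)
  have h14 : c 14 = 0 := by
    simpa [h4, h5] using hc ![![1, 0, 0], ![0, 1, 1], ![0, 1, 1]] 0 1 (by simp) (by simp)
  have h15_16 : c 15 + c 16 = 0 := by
    simpa [h0, h1, h2, h3, h6, h7, h8, h9] using
      hc ![![0, 1, 1], ![1, 1, 1], ![1, 1, 1]] 0 0 (by simp) (by simp)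
  have h17_18 : c 17 + c 18 = 0 := by
    simpa [h0, h1, h4, h5, h6, h10, h11, h14] using
      hc ![![1, 0, 1], ![1, 1, 1], ![1, 1, 1]] 0 1 (by simp) (by simp)
  have h19_20 : c 19 + c 20 = 0 := by
    simpa [h2, h3, h4, h5, h9, h12, h13, h14] using
      hc ![![1, 1, 0], ![1, 1, 1], ![1, 1, 1]] 0 2 (by simp) (by simp)
  have h17_19 : c 17 + c 19 = 0 := by
    simpa [h0, h2, h4, h5, h7, h10, h12, h14] using
      hc ![![1, 1, 1], ![0, 1, 1], ![1, 1, 1]] 1 0 (by simp) (by simp)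
  have h15_20 : c 15 + c 20 = 0 := by
    simpa [h1, h2, h3, h4, h8, h9, h11, h12] using
      hc ![![1, 1, 1], ![1, 0, 1], ![1, 1, 1]] 1 1 (by simp) (by simp)
  refine ⟨c 15, fun A => ?_⟩
  have h16 : c 16 = -c 15 := by linear_combination h15_16
  have h20 : c 20 = -c 15 := by linear_combination h15_20
  have h19 : c 19 = c 15 := by linear_combination h19_20 - h15_20
  have h17 : c 17 = -c 15 := by linear_combination h17_19 - h19_20 + h15_20
  have h18 : c 18 = c 15 := by linear_combination h17_18 - h17_19 + h19_20 - h15_20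
  rw [h0, h1, h2, h3, h4, h5, h6, h7, h8, h9, h10, h11, h12, h13, h14, h16, h17, h18, h19, h20]
  simp [Ver, Δ3, frame, Matrix.det_fin_three]
  ring

lemma eq_mul_Ver_of_frame {P : (Fin 6 → Fin 3 → ℂ) → ℂ} (hP : Continuous P)
    (hmul : ∀ (M : Matrix (Fin 3) (Fin 3) ℂ) v, P (fun i => M.mulVec (v i)) = M.det ^ 4 * P v)
    {a : ℂ} (hframe : ∀ A, P (frame A) = a * Ver (frame A)) (v : Fin 6 → Fin 3 → ℂ) :
    P v = a * Ver v := by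
  have generic (v : Fin 6 → Fin 3 → ℂ) (hv : Δ3 v 0 1 2 ≠ 0) : P v = a * Ver v := by
    rw [eq_mulVec_frame v _ rfl hv, hmul, Ver_mulVec, hframe]
    ring
  let w : ℂ → Fin 6 → Fin 3 → ℂ := fun t i => v i + t • frame 0 i
  have hw : Continuous w := by
    unfold w
    fun_prop
  let M : Matrix (Fin 3) (Fin 3) ℂ := Matrix.of fun i j => ![v 0, v 1, v 2] j i
  have hdet (t : ℂ) : Δ3 (w t) 0 1 2 = (-M).charpoly.eval t := by
    rw [Matrix.eval_charpoly, Δ3]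
    congr 1
    ext i j
    fin_cases i <;> fin_cases j <;>
      simp [w, M, frame, Matrix.vecHead, Matrix.vecTail, add_comm (v _ _)]
  have hfin : {t | (-M).charpoly.eval t = 0}.Finite := by
    simpa [Polynomial.IsRoot] using
      Polynomial.finite_setOfPred_isRoot (Matrix.charpoly_monic (-M)).ne_zero
  have heq : (fun t => P (w t)) = fun t => a * Ver (w t) :=
    Continuous.ext_on (hfin.countable.dense_compl ℂ) (hP.comp hw)
      (continuous_const.mul (continuous_Ver.comp hw)) fun t ht => generic _ (by rwa [hdet])
  simpa [w] using congrFun heq 0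

/-- If `P` is a linear combination of products `Δ_{J₁}Δ_{J₂}Δ_{J₃}Δ_{J₄}` of four `3 × 3`
determinants in which each index `1, …, 6` occurs exactly twice, and `P` vanishes whenever
there is a partition `{a,b,c} ⊔ {d,e,f} = {1,…,6}` with `Δ_{abc} = Δ_{def} = 0`, then `P` is a
scalar multiple of the Veronese polynomial. -/
theorem stmt13 (P : (Fin 6 → Fin 3 → ℂ) → ℂ)
    (hP : ∃ coef : (Fin 4 → Fin 3 → Fin 6) → ℂ,
      (∀ T : Fin 4 → Fin 3 → Fin 6, coef T ≠ 0 → ∀ idx : Fin 6,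
        ((Finset.univ : Finset (Fin 4 × Fin 3)).filter (fun ts => T ts.1 ts.2 = idx)).card = 2) ∧
      ∀ v : Fin 6 → Fin 3 → ℂ,
        P v = ∑ T : Fin 4 → Fin 3 → Fin 6, coef T * ∏ t : Fin 4, Δ3 v (T t 0) (T t 1) (T t 2))
    (hvan : ∀ v : Fin 6 → Fin 3 → ℂ,
      (∃ a b c d e f : Fin 6, ({a, b, c, d, e, f} : Finset (Fin 6)) = Finset.univ ∧
        Δ3 v a b c = 0 ∧ Δ3 v d e f = 0) → P v = 0) :
    ∃ c : ℂ, ∀ v : Fin 6 → Fin 3 → ℂ, P v = c * Ver v := by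
  obtain ⟨coef, hcoef, hP⟩ := hP
  obtain rfl : P = combΔ3 coef := funext hP
  obtain ⟨c, hc⟩ := exists_combΔ3_frame_eq_sum hcoef
  obtain ⟨a, ha⟩ := exists_eq_mul_Ver_frame c fun A k l h0 h1 => by
    rw [← hc]
    exact hvan _ (Δ3_frame_eq_zero A k l h0 h1)
  exact ⟨a, eq_mul_Ver_of_frame (continuous_combΔ3 coef) (combΔ3_mulVec coef)
    fun A => (hc A).trans (ha A)⟩
end
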